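/- arXiv:2408.04101 — 2 statements merged into one kernel-verified Lean document; each statement's English description precedes it below -/
import Mathlib

section
/- Let μ_X, μ_Y ∈ ℝ, σ_X, σ_Y > 0, n ≥ 1 an integer, and consider the degenerate case ρ = −1, i.e. X = σ_X N + μ_X and Y = −σ_Y N + μ_Y for N ~ N(0,1). Then S_n has the same distribution as (n s/4)(μ_X/σ_X + μ_Y/σ_Y)² − s V₂, where V₂ ~ χ'²_n(λ₋) with λ₋ = n(μ_X/σ_X − μ_Y/σ_Y)²/4. -/
open MeasureTheory ProbabilityTheory Real

noncomputable section

/-- Modified Bessel function of the first kind,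
`I ν y = ∑_{k=0}^∞ (y/2)^{2k+ν} / (k! Γ(k+ν+1))`. -/
def besselI (ν y : ℝ) : ℝ :=
  ∑' k : ℕ, (y / 2) ^ (2 * (k : ℝ) + ν) / ((k.factorial : ℝ) * Real.Gamma ((k : ℝ) + ν + 1))

/-- The density of the noncentral chi-square distribution with `r` degrees of freedom and
noncentrality parameter `lam` (for `lam = 0`, the chi-square density). -/
def ncChiSqPdf (r lam x : ℝ) : ℝ :=
  if x ≤ 0 then 0
  else if lam = 0 then x ^ (r / 2 - 1) * Real.exp (-x / 2) / (2 ^ (r / 2) * Real.Gamma (r / 2))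
  else (1 / 2) * Real.exp (-(x + lam) / 2) * (x / lam) ^ (r / 4 - 1 / 2) *
    besselI (r / 2 - 1) (Real.sqrt (lam * x))

/-- The noncentral chi-square distribution `χ'²_r(lam)` as a measure on `ℝ`. -/
def ncChiSq (r lam : ℝ) : Measure ℝ :=
  volume.withDensity fun x => ENNReal.ofReal (ncChiSqPdf r lam x)

/-- The law of the difference `T = V₁ - V₂` of independent noncentral chi-square random
variables `V₁ ~ χ'²_r(λ₁)` and `V₂ ~ χ'²_r(λ₂)`. -/
def ncChiSqDiff (r lam1 lam2 : ℝ) : Measure ℝ :=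
  Measure.map (fun p : ℝ × ℝ => p.1 - p.2) ((ncChiSq r lam1).prod (ncChiSq r lam2))

/-- The law of `Z = XY` where `X = σX N + μX`, `Y = -σY N + μY` for a single standard normal
`N` (the degenerate bivariate normal case `ρ = -1`). -/
def prodNormalDegNeg (μX μY σX σY : ℝ) : Measure ℝ :=
  Measure.map (fun x : ℝ => (σX * x + μX) * (-σY * x + μY)) (gaussianReal 0 1)

/-- The law of the sum `Sₙ = Z₁ + ⋯ + Zₙ` of `n` independent copies of `Z` (case `ρ = -1`). -/
def sumProdNormalDegNeg (n : ℕ) (μX μY σX σY : ℝ) : Measure ℝ :=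
  Measure.map (fun x : Fin n → ℝ => ∑ i, x i)
    (Measure.pi fun _ : Fin n => prodNormalDegNeg μX μY σX σY)

/-- The moment generating function of the gamma distribution. -/
lemma mgf_gammaMeasure {a r t : ℝ} (ha : 0 < a) (hr : 0 < r) (ht : t < r) :
    mgf id (gammaMeasure a r) t = (r / (r - t)) ^ a := by
  have hrt : 0 < r - t := sub_pos.2 ht
  rw [mgf, gammaMeasure, integral_withDensity_eq_integral_toReal_smul (f := gammaPDF a r)
    (measurable_gammaPDFReal a r).ennreal_ofReal (ae_of_all _ fun _ ↦ ENNReal.ofReal_lt_top)]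
  have h (x : ℝ) : (gammaPDF a r x).toReal = gammaPDFReal a r x :=
    ENNReal.toReal_ofReal (gammaPDFReal_nonneg ha hr x)
  simp only [h, smul_eq_mul, id]
  rw [← setIntegral_eq_integral_of_forall_compl_eq_zero (s := Set.Ici 0)
    fun x hx ↦ by rw [gammaPDFReal, if_neg (by simpa using hx), zero_mul],
    integral_Ici_eq_integral_Ioi]
  calc ∫ x in Set.Ioi 0, gammaPDFReal a r x * exp (t * x)
      = ∫ x in Set.Ioi 0, r ^ a / Gamma a * (x ^ (a - 1) * exp (-((r - t) * x))) := by
        refine setIntegral_congr_fun measurableSet_Ioi fun x hx ↦ ?_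
        have hx' : (0 : ℝ) ≤ x := le_of_lt hx
        simp only [gammaPDFReal, if_pos hx']
        rw [show -((r - t) * x) = -(r * x) + t * x by ring, exp_add]
        ring
    _ = (r / (r - t)) ^ a := by
        rw [integral_const_mul, integral_rpow_mul_exp_neg_mul_Ioi ha hrt,
          div_rpow hr.le hrt.le, div_rpow zero_le_one hrt.le, one_rpow]
        have := (Gamma_pos_of_pos ha).ne'
        field_simp

lemma mem_integrableExpSet_gammaMeasure {a r t : ℝ} (ha : 0 < a) (hr : 0 < r) (ht : t < r) :
    t ∈ integrableExpSet id (gammaMeasure a r) := by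
  by_contra h
  have h0 : mgf id (gammaMeasure a r) t = 0 := integral_undef h
  rw [mgf_gammaMeasure ha hr ht] at h0
  exact (rpow_pos_of_pos (div_pos hr (sub_pos.2 ht)) a).ne' h0

/-- The complex moment generating function of the gamma distribution. -/
lemma complexMGF_gammaMeasure {a r : ℝ} (ha : 0 < a) (hr : 0 < r) {z : ℂ} (hz : z.re < r) :
    complexMGF id (gammaMeasure a r) z = (r / (r - z)) ^ (a : ℂ) := by
  have hU : IsOpen {z : ℂ | z.re < r} := isOpen_lt Complex.continuous_re continuous_const
  have hsub (w : ℂ) (hw : w.re < r) : 0 < (r - w).re := by simpa using hw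
  have h0 (w : ℂ) (hw : w.re < r) : (r : ℂ) - w ≠ 0 := fun h ↦ by
    have := hsub w hw
    simp [h] at this
  have hslit (w : ℂ) (hw : w.re < r) : (r : ℂ) / (r - w) ∈ Complex.slitPlane := by
    left
    rw [Complex.div_re]
    have := hsub w hw
    have hn : 0 < Complex.normSq (r - w) := Complex.normSq_pos.2 (h0 w hw)
    simp only [Complex.ofReal_re, Complex.ofReal_im, zero_mul, zero_div, add_zero]
    positivity
  have hinterior : {z : ℂ | z.re < r} ⊆
      {z | z.re ∈ interior (integrableExpSet id (gammaMeasure a r))} := fun w hw ↦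
    interior_maximal (fun t ht ↦ mem_integrableExpSet_gammaMeasure ha hr ht) isOpen_Iio hw
  have hf : AnalyticOnNhd ℂ (complexMGF id (gammaMeasure a r)) {z : ℂ | z.re < r} :=
    analyticOnNhd_complexMGF.mono hinterior
  have hg : AnalyticOnNhd ℂ (fun w : ℂ ↦ ((r : ℂ) / (r - w)) ^ (a : ℂ)) {z : ℂ | z.re < r} := by
    refine DifferentiableOn.analyticOnNhd (fun w hw ↦ ?_) hU
    refine DifferentiableAt.differentiableWithinAt ?_
    refine DifferentiableAt.cpow ?_ (by fun_prop) (hslit w hw)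
    exact (differentiableAt_const _).div (by fun_prop) (h0 w hw)
  refine hf.eqOn_of_preconnected_of_frequently_eq hg
    (convex_halfSpace_re_lt r).isPreconnected (z₀ := 0) (by simpa using hr) ?_ hz
  have htend : Filter.Tendsto ((↑) : ℝ → ℂ) (nhdsWithin 0 {0}ᶜ) (nhdsWithin 0 {0}ᶜ) := by
    refine tendsto_nhdsWithin_iff.2 ⟨?_, ?_⟩
    · exact (Complex.continuous_ofReal.tendsto' 0 0 (by simp)).mono_left nhdsWithin_le_nhds
    · filter_upwards [self_mem_nhdsWithin] with t ht
      simpa using ht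
  refine htend.frequently (Filter.Eventually.frequently ?_)
  filter_upwards [nhdsWithin_le_nhds (Iio_mem_nhds hr)] with t ht
  rw [complexMGF_ofReal, mgf_gammaMeasure ha hr ht,
    Complex.ofReal_cpow (div_pos hr (sub_pos.2 ht)).le]
  push_cast
  rfl

/-- The series defining the modified Bessel function converges. -/
lemma summable_besselI {ν y : ℝ} (hν : 0 < ν + 1) (hy : 0 < y) :
    Summable fun k : ℕ ↦
      (y / 2) ^ (2 * (k : ℝ) + ν) / ((k.factorial : ℝ) * Gamma ((k : ℝ) + ν + 1)) := by
  have hk (k : ℕ) : 0 < (k : ℝ) + ν + 1 := by rw [add_assoc]; positivity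
  have hG (k : ℕ) := Gamma_pos_of_pos (hk k)
  have hpos (k : ℕ) :
      0 < (y / 2) ^ (2 * (k : ℝ) + ν) / ((k.factorial : ℝ) * Gamma ((k : ℝ) + ν + 1)) := by
    have := hG k
    positivity
  refine summable_of_ratio_test_tendsto_lt_one zero_lt_one
    (Filter.Eventually.of_forall fun k ↦ (hpos k).ne') ?_
  have heq (k : ℕ) : (y / 2) ^ 2 * (1 / ((k : ℝ) + 1)) * (1 / ((k : ℝ) + (ν + 1))) =
      ‖(y / 2) ^ (2 * ((k + 1 : ℕ) : ℝ) + ν) /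
        (((k + 1).factorial : ℝ) * Gamma (((k + 1 : ℕ) : ℝ) + ν + 1))‖ /
      ‖(y / 2) ^ (2 * (k : ℝ) + ν) / ((k.factorial : ℝ) * Gamma ((k : ℝ) + ν + 1))‖ := by
    rw [Real.norm_of_nonneg (hpos k).le, Real.norm_of_nonneg (hpos (k + 1)).le]
    have h1 : (y / 2) ^ (2 * ((k + 1 : ℕ) : ℝ) + ν) =
        (y / 2) ^ (2 * (k : ℝ) + ν) * (y / 2) ^ 2 := by
      rw [← rpow_natCast (y / 2) 2, ← rpow_add (by positivity)]
      congr 1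
      push_cast
      ring
    have h2 : Gamma (((k + 1 : ℕ) : ℝ) + ν + 1) =
        ((k : ℝ) + (ν + 1)) * Gamma ((k : ℝ) + ν + 1) := by
      rw [← add_assoc, ← Gamma_add_one (hk k).ne']
      congr 1
      push_cast
      ring
    rw [h1, h2, Nat.factorial_succ]
    have := (hG k).ne'
    have h3 : (k : ℝ) + (ν + 1) ≠ 0 := by rw [← add_assoc]; exact (hk k).ne'
    have h4 : (y / 2) ^ (2 * (k : ℝ) + ν) ≠ 0 := by positivity
    push_cast
    field_simp
  refine Filter.Tendsto.congr heq ?_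
  have h1 := tendsto_one_div_add_atTop_nhds_zero_nat (𝕜 := ℝ)
  have h2 : Filter.Tendsto (fun k : ℕ ↦ 1 / ((k : ℝ) + (ν + 1))) Filter.atTop (nhds 0) :=
    tendsto_const_nhds.div_atTop
      (Filter.tendsto_atTop_add_const_right _ _ tendsto_natCast_atTop_atTop)
  simpa using (h1.const_mul ((y / 2) ^ 2)).mul h2

/-- The Poisson weights `e^{-λ/2} (λ/2)^k / k!`. -/
def poissonWeight (lam : ℝ) (k : ℕ) : ℝ :=
  exp (-lam / 2) * ((lam / 2) ^ k / (k.factorial : ℝ))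

lemma poissonWeight_nonneg {lam : ℝ} (hlam : 0 ≤ lam) (k : ℕ) : 0 ≤ poissonWeight lam k := by
  unfold poissonWeight
  positivity

/-- The noncentral chi-square density is a Poisson mixture of gamma densities. -/
lemma hasSum_ncChiSqPdf {r lam x : ℝ} (hr : 0 < r) (hlam : 0 ≤ lam) (hx : 0 < x) :
    HasSum (fun k : ℕ ↦ poissonWeight lam k * gammaPDFReal (k + r / 2) (1 / 2) x)
      (ncChiSqPdf r lam x) := by
  rw [ncChiSqPdf, if_neg hx.not_ge]
  rcases hlam.eq_or_lt with rfl | hlam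
  · rw [if_pos rfl]
    have h0 : poissonWeight 0 0 * gammaPDFReal ((0 : ℕ) + r / 2) (1 / 2) x =
        x ^ (r / 2 - 1) * exp (-x / 2) / (2 ^ (r / 2) * Gamma (r / 2)) := by
      simp only [poissonWeight, gammaPDFReal, if_pos hx.le]
      rw [div_rpow zero_le_one zero_le_two, one_rpow, show -x / 2 = -(1 / 2 * x) by ring]
      simp
      ring
    rw [← h0]
    exact hasSum_single 0 fun k hk ↦ by simp [poissonWeight, hk]
  · rw [if_neg hlam.ne', besselI]
    have hs : 0 < sqrt (lam * x) := sqrt_pos.2 (mul_pos hlam hx)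
    refine ((summable_besselI (by linarith) hs).hasSum.mul_left _).congr_fun fun k ↦ ?_
    have hG : (k : ℝ) + (r / 2 - 1) + 1 = k + r / 2 := by ring
    have hGpos : 0 < Gamma ((k : ℝ) + r / 2) := Gamma_pos_of_pos (by positivity)
    simp only [poissonWeight, gammaPDFReal, if_pos hx.le, hG]
    have key : (x / lam) ^ (r / 4 - 1 / 2) * (sqrt (lam * x) / 2) ^ (2 * (k : ℝ) + (r / 2 - 1)) =
        exp (log 2) * ((lam / 2) ^ k * (1 / 2) ^ ((k : ℝ) + r / 2) * x ^ ((k : ℝ) + r / 2 - 1)) := by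
      rw [← rpow_natCast (lam / 2), rpow_def_of_pos (by positivity), rpow_def_of_pos (by positivity),
        rpow_def_of_pos (by positivity), rpow_def_of_pos (by positivity), rpow_def_of_pos hx,
        log_div hx.ne' hlam.ne', log_div hs.ne' two_ne_zero, log_sqrt (by positivity),
        log_mul hlam.ne' hx.ne', log_div hlam.ne' two_ne_zero, log_div one_ne_zero two_ne_zero,
        log_one]
      simp only [← exp_add]
      congr 1
      ring
    have hexp : exp (-(x + lam) / 2) = exp (-lam / 2) * exp (-(1 / 2 * x)) := by
      rw [← exp_add]
      congr 1
      ring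
    rw [exp_log two_pos] at key
    rw [hexp, mul_assoc _ ((x / lam) ^ _), ← mul_div_assoc ((x / lam) ^ _), key]
    field_simp

lemma ncChiSq_eq_sum {r lam : ℝ} (hr : 0 < r) (hlam : 0 ≤ lam) :
    ncChiSq r lam = Measure.sum fun k : ℕ ↦
      ENNReal.ofReal (poissonWeight lam k) • gammaMeasure (k + r / 2) (1 / 2) := by
  have hmeas (k : ℕ) : Measurable (gammaPDF (k + r / 2) (1 / 2)) :=
    (measurable_gammaPDFReal _ _).ennreal_ofReal
  simp only [gammaMeasure, ← withDensity_smul _ (hmeas _)]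
  rw [← withDensity_tsum fun k ↦ (hmeas k).const_smul _, ncChiSq]
  refine withDensity_congr_ae ?_
  filter_upwards [Measure.ae_ne volume (0 : ℝ)] with x hx
  rw [tsum_apply (Pi.summable.2 fun _ ↦ ENNReal.summable)]
  simp only [Pi.smul_apply, smul_eq_mul]
  rcases lt_or_gt_of_ne hx with hx | hx
  · simp [ncChiSqPdf, hx.le, gammaPDF_of_neg hx]
  · have h := hasSum_ncChiSqPdf hr hlam hx
    rw [← h.tsum_eq, ENNReal.ofReal_tsum_of_nonneg (fun k ↦ mul_nonneg (poissonWeight_nonneg hlam k)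
      (gammaPDFReal_nonneg (by positivity) (by norm_num) x)) h.summable]
    exact tsum_congr fun k ↦ ENNReal.ofReal_mul (poissonWeight_nonneg hlam k)

lemma isFiniteMeasure_ncChiSq {r lam : ℝ} (hr : 0 < r) (hlam : 0 ≤ lam) :
    IsFiniteMeasure (ncChiSq r lam) where
  measure_univ_lt_top := by
    have hprob (k : ℕ) : IsProbabilityMeasure (gammaMeasure (k + r / 2) (1 / 2)) :=
      isProbabilityMeasure_gammaMeasure (by positivity) (by norm_num)
    have hsum : Summable (poissonWeight lam) :=
      (Real.summable_pow_div_factorial (lam / 2)).mul_left _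
    rw [ncChiSq_eq_sum hr hlam, Measure.sum_apply _ MeasurableSet.univ]
    simp only [Measure.smul_apply, measure_univ, smul_eq_mul, mul_one]
    rw [← ENNReal.ofReal_tsum_of_nonneg (poissonWeight_nonneg hlam) hsum]
    exact ENNReal.ofReal_lt_top

/-- The characteristic function of the noncentral chi-square distribution. -/
lemma charFun_ncChiSq {r lam : ℝ} (hr : 0 < r) (hlam : 0 ≤ lam) (t : ℝ) :
    charFun (ncChiSq r lam) t =
      (1 / 2 / (1 / 2 - t * Complex.I) : ℂ) ^ (r / 2 : ℂ) *
        Complex.exp (lam / 2 * (1 / 2 / (1 / 2 - t * Complex.I) - 1)) := by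
  have hfin := isFiniteMeasure_ncChiSq hr hlam
  set q : ℂ := 1 / 2 / (1 / 2 - t * Complex.I) with hq
  have hq0 : q ≠ 0 := by
    refine div_ne_zero (by norm_num) fun h ↦ ?_
    simpa using congrArg Complex.re h
  have hint : Integrable (fun x : ℝ ↦ Complex.exp (t * x * Complex.I)) (ncChiSq r lam) := by
    refine Integrable.of_bound (by fun_prop) 1 (ae_of_all _ fun x ↦ ?_)
    rw [← Complex.ofReal_mul, Complex.norm_exp_ofReal_mul_I]
  rw [ncChiSq_eq_sum hr hlam] at hint
  have hgamma (k : ℕ) : ∫ x : ℝ, Complex.exp (t * x * Complex.I)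
      ∂(ENNReal.ofReal (poissonWeight lam k) • gammaMeasure (k + r / 2) (1 / 2)) =
      q ^ (r / 2 : ℂ) * Complex.exp (-lam / 2) * ((lam / 2 * q) ^ k / k.factorial) := by
    rw [integral_smul_measure, ENNReal.toReal_ofReal (poissonWeight_nonneg hlam k),
      ← charFun_apply_real, ← complexMGF_id_mul_I,
      complexMGF_gammaMeasure (by positivity) (by norm_num) (by simp), Complex.real_smul,
      poissonWeight]
    push_cast
    rw [← hq, Complex.cpow_add _ _ hq0, Complex.cpow_natCast, mul_pow]
    clear_value q
    ring
  have h1 := hasSum_integral_measure hint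
  simp only [hgamma] at h1
  have h2 := (NormedSpace.expSeries_div_hasSum_exp (lam / 2 * q)).mul_left
    (q ^ (r / 2 : ℂ) * Complex.exp (-lam / 2))
  rw [charFun_apply_real, ncChiSq_eq_sum hr hlam, h1.unique h2, ← Complex.exp_eq_exp_ℂ, mul_assoc,
    ← Complex.exp_add]
  ring_nf

lemma ofReal_mul_cpow_of_pos {a : ℝ} (ha : 0 < a) {z : ℂ} (hz : z ≠ 0) (w : ℂ) :
    (a * z) ^ w = (a : ℂ) ^ w * z ^ w := by
  have ha' : (a : ℂ) ≠ 0 := Complex.ofReal_ne_zero.2 ha.ne'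
  rw [Complex.cpow_def_of_ne_zero (mul_ne_zero ha' hz), Complex.cpow_def_of_ne_zero ha',
    Complex.cpow_def_of_ne_zero hz, Complex.log_ofReal_mul ha hz, Complex.ofReal_log ha.le,
    ← Complex.exp_add, add_mul]

/-- The characteristic function of `(N + d)²` for a standard normal variable `N`. -/
lemma integral_cexp_sq_gaussianReal (t d : ℝ) :
    ∫ x : ℝ, Complex.exp (t * ((x + d) ^ 2 : ℝ) * Complex.I) ∂(gaussianReal 0 1) =
      (1 / 2 / (1 / 2 - t * Complex.I) : ℂ) ^ (1 / 2 : ℂ) *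
        Complex.exp (d ^ 2 / 2 * (1 / 2 / (1 / 2 - t * Complex.I) - 1)) := by
  have hre : (1 / 2 - t * Complex.I : ℂ).re = 1 / 2 := by simp
  set p : ℂ := 1 / 2 - t * Complex.I with hp
  have hp0 : p ≠ 0 := fun h ↦ by
    rw [h] at hre
    norm_num at hre
  have htI : t * Complex.I = 1 / 2 - p := by rw [hp]; ring
  rw [integral_gaussianReal_eq_integral_smul one_ne_zero]
  have hfun (x : ℝ) : gaussianPDFReal 0 1 x • Complex.exp (t * ((x + d) ^ 2 : ℝ) * Complex.I) =
      ((√(2 * π))⁻¹ : ℝ) * Complex.exp (-p * x ^ 2 + (1 - 2 * p) * d * x + (1 / 2 - p) * d ^ 2) := by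
    rw [gaussianPDFReal, Complex.real_smul, Complex.ofReal_mul, mul_assoc, Complex.ofReal_exp,
      ← Complex.exp_add, show (t : ℂ) * ((x + d) ^ 2 : ℝ) * Complex.I
        = (t * Complex.I) * ((x + d) ^ 2 : ℝ) by ring, htI]
    congr 2
    · simp
    · push_cast
      ring
  simp only [hfun]
  rw [integral_const_mul, integral_cexp_quadratic (by rw [Complex.neg_re, hre]; norm_num),
    ← mul_assoc]
  congr 1
  · have h2π : (0 : ℝ) < 2 * π := by positivity
    rw [show (π : ℂ) / - -p = ((2 * π : ℝ) : ℂ) * (1 / 2 / p) by push_cast; field_simp,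
      ofReal_mul_cpow_of_pos h2π (div_ne_zero (by norm_num) hp0), ← mul_assoc, sqrt_eq_rpow,
      Complex.ofReal_inv, Complex.ofReal_cpow h2π.le]
    have : (((2 * π : ℝ) : ℂ)) ^ (1 / 2 : ℂ) ≠ 0 := by
      rw [Ne, Complex.cpow_eq_zero_iff]
      simp [pi_ne_zero]
    push_cast at this ⊢
    rw [inv_mul_cancel₀ this, one_mul]
  · congr 1
    field_simp
    ring

/-- A sum of squares of `n` independent normal variables with mean `d` and unit variance is
noncentral chi-square distributed. -/
lemma map_sum_sq_gaussianReal {n : ℕ} (hn : 1 ≤ n) (d : ℝ) :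
    Measure.map (fun x : Fin n → ℝ ↦ ∑ i, (x i + d) ^ 2)
      (Measure.pi fun _ ↦ gaussianReal 0 1) = ncChiSq n (n * d ^ 2) := by
  have hn' : (0 : ℝ) < n := by exact_mod_cast hn
  have hlam : 0 ≤ n * d ^ 2 := by positivity
  have hfin := isFiniteMeasure_ncChiSq hn' hlam
  have hmeas : Measurable fun x : Fin n → ℝ ↦ ∑ i, (x i + d) ^ 2 := by fun_prop
  refine Measure.ext_of_charFun (funext fun t ↦ ?_)
  rw [charFun_ncChiSq hn' hlam, charFun_apply_real, integral_map hmeas.aemeasurable (by fun_prop)]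
  have hprod (x : Fin n → ℝ) : Complex.exp (t * (∑ i, (x i + d) ^ 2 : ℝ) * Complex.I) =
      ∏ i, Complex.exp (t * ((x i + d) ^ 2 : ℝ) * Complex.I) := by
    rw [← Complex.exp_sum, Complex.ofReal_sum, Finset.mul_sum, Finset.sum_mul]
  simp only [hprod]
  rw [integral_fintype_prod_eq_pow fun y : ℝ ↦ Complex.exp (t * ((y + d) ^ 2 : ℝ) * Complex.I),
    integral_cexp_sq_gaussianReal, Fintype.card_fin, mul_pow, ← Complex.cpow_nat_mul,
    ← Complex.exp_nat_mul]
  push_cast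
  ring_nf

/-- In the degenerate case `ρ = -1`, the sum `Sₙ` has the same distribution as
`(n s/4)(μX/σX + μY/σY)² - s V₂`, where `s = σX σY` and `V₂ ~ χ'²_n(λ₋)` with
`λ₋ = n (μX/σX - μY/σY)² / 4`. -/
theorem sumProdNormalDegNeg_eq (μX μY σX σY : ℝ) (hσX : 0 < σX) (hσY : 0 < σY)
    (n : ℕ) (hn : 1 ≤ n) :
    sumProdNormalDegNeg n μX μY σX σY =
      Measure.map
        (fun v : ℝ =>
          (n : ℝ) * (σX * σY) / 4 * (μX / σX + μY / σY) ^ 2 - σX * σY * v)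
        (ncChiSq n ((n : ℝ) * (μX / σX - μY / σY) ^ 2 / 4)) := by
  have hmeas : Measurable fun x : ℝ ↦ (σX * x + μX) * (-σY * x + μY) := by fun_prop
  have hprob : IsProbabilityMeasure (prodNormalDegNeg μX μY σX σY) :=
    Measure.isProbabilityMeasure_map hmeas.aemeasurable
  have hlam : (n : ℝ) * (μX / σX - μY / σY) ^ 2 / 4 = n * ((μX / σX - μY / σY) / 2) ^ 2 := by ring
  rw [sumProdNormalDegNeg, hlam, ← map_sum_sq_gaussianReal hn,
    Measure.map_map (by fun_prop) (by fun_prop)]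
  have hpi : (Measure.pi fun _ : Fin n ↦ prodNormalDegNeg μX μY σX σY) =
      Measure.map (fun (x : Fin n → ℝ) i ↦ (σX * x i + μX) * (-σY * x i + μY))
        (Measure.pi fun _ ↦ gaussianReal 0 1) :=
    (Measure.pi_map_pi (hμ := fun _ ↦ by
      rw [← prodNormalDegNeg]; infer_instance) fun _ ↦ hmeas.aemeasurable).symm
  rw [hpi, Measure.map_map (by fun_prop) (by fun_prop)]
  congr 1
  ext x
  have hsq (y : ℝ) : (σX * y + μX) * (-σY * y + μY) =
      σX * σY / 4 * (μX / σX + μY / σY) ^ 2 -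
        σX * σY * (y + (μX / σX - μY / σY) / 2) ^ 2 := by
    field_simp
    ring
  simp only [Function.comp_apply, hsq, Finset.sum_sub_distrib, ← Finset.mul_sum,
    Finset.sum_const, Finset.card_univ, Fintype.card_fin, nsmul_eq_mul]
  ring

end
end

section
/- Let T = V₁ − V₂, where V₁ ~ χ'²_r(λ₁) and V₂ ~ χ'²_r(λ₂) are independent, with r > 0 and λ₁, λ₂ ≥ 0, and let p_T denote the probability density function of T (which is continuous on ℝ ∖ {0}). Then p_T is bounded on ℝ ∖ {0} if and only if r > 1. -/
open MeasureTheory ProbabilityTheory Real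

noncomputable section

/-- The entire function `∑ z ^ k / (k! Γ(k + a))` underlying the Bessel function `I_{a-1}`. -/
def besselSeries (a z : ℝ) : ℝ :=
  ∑' k : ℕ, z ^ k / ((k.factorial : ℝ) * Real.Gamma ((k : ℝ) + a))

theorem exists_pow_div_Gamma_le {a : ℝ} (ha : 0 < a) {M : ℝ} (hM : 0 < M) :
    ∃ C : ℝ, 0 < C ∧ ∀ k : ℕ, M ^ k / Real.Gamma ((k : ℝ) + a) ≤ C := by
  have hG : ∀ k : ℕ, 0 < Real.Gamma ((k : ℝ) + a) := fun k => Real.Gamma_pos_of_pos (by positivity)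
  have hs : Summable fun k : ℕ => M ^ k / Real.Gamma ((k : ℝ) + a) := by
    refine summable_of_ratio_test_tendsto_lt_one (l := 0) one_pos
      (Filter.Eventually.of_forall fun k => (div_pos (pow_pos hM k) (hG k)).ne') ?_
    have hlim : Filter.Tendsto (fun k : ℕ => M / ((k : ℝ) + a)) Filter.atTop (nhds 0) :=
      (Filter.tendsto_atTop_add_const_right _ a tendsto_natCast_atTop_atTop).const_div_atTop M
    refine hlim.congr fun k => ?_
    have hk : (k : ℝ) + a ≠ 0 := by positivity
    have h := hG k
    rw [Real.norm_of_nonneg (div_pos (pow_pos hM _) (hG _)).le,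
      Real.norm_of_nonneg (div_pos (pow_pos hM _) (hG _)).le]
    push_cast
    rw [show (k : ℝ) + 1 + a = (k + a) + 1 by ring, Real.Gamma_add_one hk, pow_succ]
    field_simp
  have hpos : ∀ k : ℕ, 0 < M ^ k / Real.Gamma ((k : ℝ) + a) :=
    fun k => div_pos (pow_pos hM k) (hG k)
  exact ⟨_, hs.tsum_pos (fun k => (hpos k).le) 0 (hpos 0),
    fun k => hs.le_tsum k fun j _ => (hpos j).le⟩

theorem summable_besselSeries {a : ℝ} (ha : 0 < a) (z : ℝ) :
    Summable fun k : ℕ => z ^ k / ((k.factorial : ℝ) * Real.Gamma ((k : ℝ) + a)) := by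
  obtain ⟨C, -, hC⟩ := exists_pow_div_Gamma_le ha one_pos
  refine Summable.of_norm_bounded ((Real.summable_pow_div_factorial |z|).mul_left C) fun k => ?_
  have hG : 0 < Real.Gamma ((k : ℝ) + a) := Real.Gamma_pos_of_pos (by positivity)
  have h := mul_le_mul_of_nonneg_right (hC k)
    (show 0 ≤ |z| ^ k / (k.factorial : ℝ) by positivity)
  rw [Real.norm_eq_abs, abs_div, abs_pow, abs_of_pos (by positivity : 0 < (k.factorial : ℝ) * _)]
  refine le_trans (le_of_eq ?_) h
  rw [one_pow]
  field_simp

theorem exists_besselSeries_le {a : ℝ} (ha : 0 < a) {M : ℝ} (hM : 0 < M) :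
    ∃ C : ℝ, 0 < C ∧ ∀ z : ℝ, 0 ≤ z → besselSeries a z ≤ C * Real.exp (z / M) := by
  obtain ⟨C, hC0, hC⟩ := exists_pow_div_Gamma_le ha hM
  refine ⟨C, hC0, fun z hz => ?_⟩
  have hexp : HasSum (fun k : ℕ => C * ((z / M) ^ k / (k.factorial : ℝ)))
      (C * Real.exp (z / M)) := by
    rw [Real.exp_eq_exp_ℝ]
    exact (NormedSpace.expSeries_div_hasSum_exp (z / M)).mul_left C
  refine hasSum_le (fun k => ?_) (summable_besselSeries ha z).hasSum hexp
  have hG : 0 < Real.Gamma ((k : ℝ) + a) := Real.Gamma_pos_of_pos (by positivity)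
  have h := mul_le_mul_of_nonneg_right (hC k)
    (show 0 ≤ (z / M) ^ k / (k.factorial : ℝ) by positivity)
  refine le_trans (le_of_eq ?_) h
  rw [div_pow]
  field_simp

theorem inv_Gamma_le_besselSeries {a : ℝ} (ha : 0 < a) {z : ℝ} (hz : 0 ≤ z) :
    (Real.Gamma a)⁻¹ ≤ besselSeries a z := by
  have h := (summable_besselSeries ha z).le_tsum 0 fun k _ =>
    div_nonneg (pow_nonneg hz k) (mul_nonneg (Nat.cast_nonneg _)
      (Real.Gamma_pos_of_pos (by positivity)).le)
  simpa [besselSeries] using h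

theorem measurable_besselSeries {a : ℝ} (ha : 0 < a) : Measurable (besselSeries a) := by
  refine measurable_of_tendsto_metrizable (f := fun n z => ∑ k ∈ Finset.range n,
    z ^ k / ((k.factorial : ℝ) * Real.Gamma ((k : ℝ) + a))) (fun n => by fun_prop) ?_
  exact tendsto_pi_nhds.2 fun z => (summable_besselSeries ha z).hasSum.tendsto_sum_nat

theorem ncChiSqPdf_eq {r lam x : ℝ} (hl : 0 ≤ lam) (hx : 0 < x) :
    ncChiSqPdf r lam x = 2 ^ (-(r / 2)) * Real.exp (-(x + lam) / 2) * x ^ (r / 2 - 1) *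
      besselSeries (r / 2) (lam * x / 4) := by
  rw [ncChiSqPdf, if_neg hx.not_ge]
  rcases hl.eq_or_lt with rfl | hl
  · have h : besselSeries (r / 2) 0 = (Real.Gamma (r / 2))⁻¹ := by
      rw [besselSeries, tsum_eq_single 0 fun k hk => by simp [hk]]
      simp
    rw [if_pos rfl, zero_mul, zero_div, h, add_zero, Real.rpow_neg zero_le_two, div_eq_mul_inv,
      mul_inv]
    ring
  · rw [if_neg hl.ne', besselI, besselSeries, ← tsum_mul_left, ← tsum_mul_left]
    refine tsum_congr fun k => ?_
    rw [show (k : ℝ) + (r / 2 - 1) + 1 = k + r / 2 by ring]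
    have hsq : 0 < Real.sqrt (lam * x) / 2 := by positivity
    have hpow : (Real.sqrt (lam * x) / 2) ^ (2 * (k : ℝ) + (r / 2 - 1)) =
        (lam * x / 4) ^ k * (lam * x / 4) ^ (r / 4 - 1 / 2) := by
      have h4 : Real.sqrt (lam * x) / 2 = (lam * x / 4) ^ (1 / 2 : ℝ) := by
        rw [← Real.sqrt_eq_rpow, Real.sqrt_div (by positivity),
          show (4 : ℝ) = 2 ^ 2 by norm_num, Real.sqrt_sq zero_le_two]
      rw [h4, ← Real.rpow_mul (by positivity), ← Real.rpow_natCast, ← Real.rpow_add (by positivity)]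
      ring_nf
    have hfac : (1 / 2) * (x / lam) ^ (r / 4 - 1 / 2) * (lam * x / 4) ^ (r / 4 - 1 / 2) =
        2 ^ (-(r / 2)) * x ^ (r / 2 - 1) := by
      rw [mul_assoc, ← Real.mul_rpow (by positivity) (by positivity),
        show x / lam * (lam * x / 4) = (x / 2) ^ (2 : ℝ) by
          rw [Real.rpow_two]; field_simp; norm_num,
        ← Real.rpow_mul (by positivity), show 2 * (r / 4 - 1 / 2) = r / 2 - 1 by ring,
        Real.div_rpow hx.le zero_le_two, Real.rpow_neg zero_le_two, Real.rpow_sub_one two_ne_zero]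
      field_simp
    rw [hpow]
    linear_combination (Real.exp (-(x + lam) / 2) * (lam * x / 4) ^ k /
      ((k.factorial : ℝ) * Real.Gamma (k + r / 2))) * hfac

theorem ncChiSqPdf_of_nonpos {r lam x : ℝ} (hx : x ≤ 0) : ncChiSqPdf r lam x = 0 := if_pos hx

theorem ncChiSqPdf_pos {r lam x : ℝ} (hr : 0 < r) (hl : 0 ≤ lam) (hx : 0 < x) :
    0 < ncChiSqPdf r lam x := by
  have hb : 0 < besselSeries (r / 2) (lam * x / 4) :=
    (inv_pos.2 (Real.Gamma_pos_of_pos (by positivity))).trans_le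
      (inv_Gamma_le_besselSeries (by positivity) (by positivity))
  rw [ncChiSqPdf_eq hl hx]
  positivity

theorem ncChiSqPdf_nonneg {r lam : ℝ} (hr : 0 < r) (hl : 0 ≤ lam) (x : ℝ) :
    0 ≤ ncChiSqPdf r lam x := by
  rcases le_or_gt x 0 with hx | hx
  · exact (ncChiSqPdf_of_nonpos hx).ge
  · exact (ncChiSqPdf_pos hr hl hx).le

theorem measurable_ncChiSqPdf {r lam : ℝ} (hr : 0 < r) (hl : 0 ≤ lam) :
    Measurable (ncChiSqPdf r lam) := by
  have hb := measurable_besselSeries (half_pos hr)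
  have h : ncChiSqPdf r lam = fun x => if x ≤ 0 then 0 else
      2 ^ (-(r / 2)) * Real.exp (-(x + lam) / 2) * x ^ (r / 2 - 1) *
        besselSeries (r / 2) (lam * x / 4) := by
    ext x
    split_ifs with hx
    · exact ncChiSqPdf_of_nonpos hx
    · exact ncChiSqPdf_eq hl (not_le.1 hx)
  rw [h]
  exact Measurable.ite measurableSet_Iic measurable_const (by fun_prop)

theorem exists_ncChiSqPdf_le {r lam : ℝ} (hr : 0 < r) (hl : 0 ≤ lam) :
    ∃ C : ℝ, ∀ x : ℝ, 0 < x →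
      ncChiSqPdf r lam x ≤ C * (x ^ (r / 2 - 1) * Real.exp (-(x / 4))) := by
  obtain ⟨C, hC0, hC⟩ := exists_besselSeries_le (half_pos hr) (M := lam + 1) (by positivity)
  refine ⟨2 ^ (-(r / 2)) * C, fun x hx => ?_⟩
  have hle : besselSeries (r / 2) (lam * x / 4) ≤ C * Real.exp (x / 4) := by
    refine (hC _ (by positivity)).trans
      (mul_le_mul_of_nonneg_left (Real.exp_le_exp.2 ?_) hC0.le)
    rw [div_le_iff₀ (by positivity)]
    linarith
  have hexp : Real.exp (-(x + lam) / 2) * Real.exp (x / 4) ≤ Real.exp (-(x / 4)) := by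
    rw [← Real.exp_add]
    gcongr
    linarith
  rw [ncChiSqPdf_eq hl hx]
  calc _ ≤ 2 ^ (-(r / 2)) * Real.exp (-(x + lam) / 2) * x ^ (r / 2 - 1) *
        (C * Real.exp (x / 4)) := by gcongr
    _ = 2 ^ (-(r / 2)) * C * x ^ (r / 2 - 1) *
        (Real.exp (-(x + lam) / 2) * Real.exp (x / 4)) := by ring
    _ ≤ 2 ^ (-(r / 2)) * C * x ^ (r / 2 - 1) * Real.exp (-(x / 4)) := by gcongr
    _ = _ := by ring

theorem exists_rpow_le_ncChiSqPdf {r lam : ℝ} (hr : 0 < r) (hr1 : r ≤ 1) (hl : 0 ≤ lam) :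
    ∃ c : ℝ, 0 < c ∧ ∀ x : ℝ, 0 < x → x ≤ 1 →
      c * x ^ (-(1 / 2) : ℝ) ≤ ncChiSqPdf r lam x := by
  have hG : 0 < Real.Gamma (r / 2) := Real.Gamma_pos_of_pos (by positivity)
  refine ⟨2 ^ (-(r / 2)) * Real.exp (-(1 + lam) / 2) * (Real.Gamma (r / 2))⁻¹, by positivity,
    fun x hx hx1 => ?_⟩
  rw [ncChiSqPdf_eq hl hx, mul_right_comm]
  have h1 : x ^ (-(1 / 2) : ℝ) ≤ x ^ (r / 2 - 1) :=
    Real.rpow_le_rpow_of_exponent_ge hx hx1 (by linarith)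
  have h2 := inv_Gamma_le_besselSeries (half_pos hr) (show 0 ≤ lam * x / 4 by positivity)
  gcongr

theorem lintegral_ncChiSqPdf_sq_lt_top {r lam : ℝ} (hr : 1 < r) (hl : 0 ≤ lam) :
    ∫⁻ x, ENNReal.ofReal (ncChiSqPdf r lam x) ^ 2 < ⊤ := by
  obtain ⟨C, hC⟩ := exists_ncChiSqPdf_le (zero_lt_one.trans hr) hl
  have hint : IntegrableOn (fun x : ℝ => x ^ (r - 2) * Real.exp (-(1 / 2) * x)) (Set.Ioi 0) := by
    simpa using integrableOn_rpow_mul_exp_neg_mul_rpow (p := 1) (s := r - 2) (b := 1 / 2)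
      (by linarith) one_pos (by norm_num)
  refine lt_of_le_of_lt ?_ ((integrable_indicator_iff
    measurableSet_Ioi).2 (hint.const_mul (C ^ 2))).lintegral_lt_top
  refine lintegral_mono fun x => ?_
  rw [← ENNReal.ofReal_pow (ncChiSqPdf_nonneg (zero_lt_one.trans hr) hl x)]
  refine ENNReal.ofReal_le_ofReal ?_
  rcases le_or_gt x 0 with hx | hx
  · simp [ncChiSqPdf_of_nonpos hx, hx.not_gt]
  · rw [Set.indicator_of_mem (Set.mem_Ioi.2 hx)]
    refine (pow_le_pow_left₀ (ncChiSqPdf_nonneg (zero_lt_one.trans hr) hl x) (hC x hx) 2).trans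
      (le_of_eq ?_)
    rw [mul_pow, mul_pow, ← Real.rpow_mul_natCast hx.le, ← Real.exp_nat_mul]
    push_cast
    ring_nf

/-- The density of the difference of independent noncentral chi-square variables, as a
convolution integral. -/
def ncChiSqDiffPdf (r lam1 lam2 t : ℝ) : ENNReal :=
  ∫⁻ y, ENNReal.ofReal (ncChiSqPdf r lam1 (t + y)) * ENNReal.ofReal (ncChiSqPdf r lam2 y)

theorem measurable_ncChiSqDiffPdf {r lam1 lam2 : ℝ} (hr : 0 < r) (h1 : 0 ≤ lam1)
    (h2 : 0 ≤ lam2) : Measurable (ncChiSqDiffPdf r lam1 lam2) := by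
  have hm1 := measurable_ncChiSqPdf hr h1
  have hm2 := measurable_ncChiSqPdf hr h2
  exact Measurable.lintegral_prod_right' (f := fun p : ℝ × ℝ =>
    ENNReal.ofReal (ncChiSqPdf r lam1 (p.1 + p.2)) * ENNReal.ofReal (ncChiSqPdf r lam2 p.2))
    (by fun_prop)

theorem ncChiSqDiff_eq_withDensity {r lam1 lam2 : ℝ} (hr : 0 < r) (h1 : 0 ≤ lam1)
    (h2 : 0 ≤ lam2) :
    ncChiSqDiff r lam1 lam2 = volume.withDensity (ncChiSqDiffPdf r lam1 lam2) := by
  have hm1 := measurable_ncChiSqPdf hr h1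
  have hm2 := measurable_ncChiSqPdf hr h2
  ext s hs
  have hind : Measurable (s.indicator (1 : ℝ → ENNReal)) := measurable_one.indicator hs
  rw [ncChiSqDiff, ← lintegral_indicator_one hs, lintegral_map hind (by fun_prop), ncChiSq,
    ncChiSq, prod_withDensity (by fun_prop) (by fun_prop),
    lintegral_withDensity_eq_lintegral_mul _ (by fun_prop) (by fun_prop),
    lintegral_prod_symm' _ (by fun_prop), withDensity_apply _ hs, ← lintegral_indicator hs]
  have hshift : ∀ y : ℝ, ∫⁻ x, (ENNReal.ofReal (ncChiSqPdf r lam1 x) *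
      ENNReal.ofReal (ncChiSqPdf r lam2 y)) * s.indicator 1 (x - y) =
      ∫⁻ t, (ENNReal.ofReal (ncChiSqPdf r lam1 (t + y)) *
      ENNReal.ofReal (ncChiSqPdf r lam2 y)) * s.indicator 1 t := fun y => by
    rw [← lintegral_add_right_eq_self _ y]
    simp only [add_sub_cancel_right]
  simp only [Pi.mul_apply, hshift]
  rw [lintegral_lintegral_swap (by fun_prop)]
  refine lintegral_congr fun t => ?_
  by_cases ht : t ∈ s <;> simp [ht, ncChiSqDiffPdf]

theorem ncChiSqDiffPdf_pos {r lam1 lam2 : ℝ} (hr : 0 < r) (h1 : 0 ≤ lam1) (h2 : 0 ≤ lam2)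
    (t : ℝ) : 0 < ncChiSqDiffPdf r lam1 lam2 t := by
  have hm1 := measurable_ncChiSqPdf hr h1
  have hm2 := measurable_ncChiSqPdf hr h2
  rw [ncChiSqDiffPdf, lintegral_pos_iff_support (by fun_prop)]
  have hsub : Set.Ioi (max 0 (-t)) ⊆ Function.support fun y =>
      ENNReal.ofReal (ncChiSqPdf r lam1 (t + y)) * ENNReal.ofReal (ncChiSqPdf r lam2 y) := by
    intro y hy
    obtain ⟨hy0, hyt⟩ := max_lt_iff.1 (Set.mem_Ioi.1 hy)
    exact mul_ne_zero (ENNReal.ofReal_pos.2 (ncChiSqPdf_pos hr h1 (by linarith))).ne'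
      (ENNReal.ofReal_pos.2 (ncChiSqPdf_pos hr h2 hy0)).ne'
  exact lt_of_lt_of_le (by simp) (measure_mono hsub)

theorem exists_ncChiSqDiffPdf_le {r lam1 lam2 : ℝ} (hr : 1 < r) (h1 : 0 ≤ lam1)
    (h2 : 0 ≤ lam2) : ∃ K : NNReal, ∀ t, ncChiSqDiffPdf r lam1 lam2 t ≤ K := by
  have hm1 := measurable_ncChiSqPdf (zero_lt_one.trans hr) h1
  have hm2 := measurable_ncChiSqPdf (zero_lt_one.trans hr) h2
  lift (∫⁻ x, ENNReal.ofReal (ncChiSqPdf r lam1 x) ^ 2) +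
    ∫⁻ x, ENNReal.ofReal (ncChiSqPdf r lam2 x) ^ 2 to NNReal using
    (ENNReal.add_lt_top.2 ⟨lintegral_ncChiSqPdf_sq_lt_top hr h1,
      lintegral_ncChiSqPdf_sq_lt_top hr h2⟩).ne with K hK
  refine ⟨K, fun t => ?_⟩
  rw [hK, ← lintegral_add_left_eq_self (fun x => ENNReal.ofReal (ncChiSqPdf r lam1 x) ^ 2) t,
    ← lintegral_add_left (by fun_prop)]
  refine lintegral_mono fun y => ?_
  rcases le_total (ENNReal.ofReal (ncChiSqPdf r lam1 (t + y)))
    (ENNReal.ofReal (ncChiSqPdf r lam2 y)) with h | h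
  · calc _ ≤ ENNReal.ofReal (ncChiSqPdf r lam2 y) * ENNReal.ofReal (ncChiSqPdf r lam2 y) := by
          gcongr
      _ ≤ _ := by rw [← sq]; exact le_add_self
  · calc _ ≤ ENNReal.ofReal (ncChiSqPdf r lam1 (t + y)) *
          ENNReal.ofReal (ncChiSqPdf r lam1 (t + y)) := by gcongr
      _ ≤ _ := by rw [← sq]; exact le_self_add

theorem exists_log_le_ncChiSqDiffPdf {r lam1 lam2 : ℝ} (hr : 0 < r) (hr1 : r ≤ 1)
    (h1 : 0 ≤ lam1) (h2 : 0 ≤ lam2) :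
    ∃ c : ℝ, 0 < c ∧ ∀ t : ℝ, 0 < t → t ≤ 1 / 2 →
      ENNReal.ofReal (c * Real.log (1 / 2 / t)) ≤ ncChiSqDiffPdf r lam1 lam2 t := by
  obtain ⟨c1, hc1, hb1⟩ := exists_rpow_le_ncChiSqPdf hr hr1 h1
  obtain ⟨c2, hc2, hb2⟩ := exists_rpow_le_ncChiSqPdf hr hr1 h2
  refine ⟨c1 * c2 / 2, by positivity, fun t ht ht2 => ?_⟩
  have hint : IntegrableOn (fun y : ℝ => c1 * c2 / 2 * (1 / y)) (Set.Ioc t (1 / 2)) := by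
    refine (ContinuousOn.integrableOn_Icc ?_).mono_set Set.Ioc_subset_Icc_self
    exact continuousOn_const.mul (continuousOn_const.div continuousOn_id
      fun y hy => (ht.trans_le hy.1).ne')
  have heq : c1 * c2 / 2 * Real.log (1 / 2 / t) =
      ∫ y in Set.Ioc t (1 / 2), c1 * c2 / 2 * (1 / y) := by
    rw [← intervalIntegral.integral_of_le ht2, intervalIntegral.integral_const_mul,
      integral_one_div_of_pos ht one_half_pos]
  rw [heq, ofReal_integral_eq_lintegral_ofReal hint]
  · refine le_trans (setLIntegral_mono' measurableSet_Ioc fun y hy => ?_)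
      (setLIntegral_le_lintegral (Set.Ioc t (1 / 2)) _)
    have hy0 : 0 < y := ht.trans hy.1
    rw [← ENNReal.ofReal_mul (ncChiSqPdf_nonneg hr h1 _)]
    refine ENNReal.ofReal_le_ofReal ?_
    have hb1' := hb1 (t + y) (by positivity) (by linarith [hy.2])
    have hb2' := hb2 y hy0 (by linarith [hy.2])
    have hmono : (2 * y) ^ (-(1 / 2) : ℝ) ≤ (t + y) ^ (-(1 / 2) : ℝ) :=
      Real.rpow_le_rpow_of_nonpos (by positivity) (by linarith [hy.1]) (by norm_num)
    have hhalf : (1 / 2 : ℝ) ≤ 2 ^ (-(1 / 2) : ℝ) := by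
      rw [one_div, ← Real.rpow_neg_one]
      exact Real.rpow_le_rpow_of_exponent_le one_le_two (by norm_num)
    have hyy : y ^ (-(1 / 2) : ℝ) * y ^ (-(1 / 2) : ℝ) = 1 / y := by
      rw [← Real.rpow_add hy0, show (-(1 / 2) + -(1 / 2) : ℝ) = -1 by norm_num,
        Real.rpow_neg_one, one_div]
    calc c1 * c2 / 2 * (1 / y) = c1 * c2 * (1 / 2) * (y ^ (-(1 / 2) : ℝ) * y ^ (-(1 / 2) : ℝ)) := by
          rw [hyy]; ring
      _ ≤ c1 * c2 * 2 ^ (-(1 / 2) : ℝ) * (y ^ (-(1 / 2) : ℝ) * y ^ (-(1 / 2) : ℝ)) := by gcongr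
      _ = c1 * (2 * y) ^ (-(1 / 2) : ℝ) * (c2 * y ^ (-(1 / 2) : ℝ)) := by
          rw [Real.mul_rpow zero_le_two hy0.le]; ring
      _ ≤ c1 * (t + y) ^ (-(1 / 2) : ℝ) * (c2 * y ^ (-(1 / 2) : ℝ)) := by gcongr
      _ ≤ _ := mul_le_mul hb1' hb2' (by positivity) (ncChiSqPdf_nonneg hr h1 _)
  · refine (ae_restrict_iff' measurableSet_Ioc).2 (Filter.Eventually.of_forall fun y hy => ?_)
    have hy0 : 0 < y := ht.trans hy.1
    simp only [Pi.zero_apply]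
    positivity

/-- Let `T = V₁ - V₂` with `V₁ ~ χ'²_r(λ₁)` and `V₂ ~ χ'²_r(λ₂)` independent,
`r > 0`, `λ₁, λ₂ ≥ 0`, and let `p_T` denote the probability density function of `T`, continuous
on `ℝ \ {0}`. Then `p_T` is bounded on `ℝ \ {0}` if and only if `r > 1`. -/
theorem ncChiSqDiff_pdf_bounded_iff (r lam1 lam2 : ℝ) (hr : 0 < r)
    (h1 : 0 ≤ lam1) (h2 : 0 ≤ lam2) (pT : ℝ → ℝ)
    (hcont : ContinuousOn pT {(0 : ℝ)}ᶜ)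
    (hpdf : ncChiSqDiff r lam1 lam2 = volume.withDensity fun x => ENNReal.ofReal (pT x)) :
    (∃ C : ℝ, ∀ x : ℝ, x ≠ 0 → |pT x| ≤ C) ↔ 1 < r := by
  have hm : AEMeasurable pT volume := by
    have h := hcont.aemeasurable (μ := volume) (measurableSet_singleton 0).compl
    rwa [restrict_compl_singleton] at h
  rw [ncChiSqDiff_eq_withDensity hr h1 h2, withDensity_eq_iff_of_sigmaFinite
    (measurable_ncChiSqDiffPdf hr h1 h2).aemeasurable hm.ennreal_ofReal] at hpdf
  constructor
  · rintro ⟨C, hC⟩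
    by_contra! hr1
    obtain ⟨c, hc, hlog⟩ := exists_log_le_ncChiSqDiffPdf hr hr1 h1 h2
    have hpos : 0 < (|C| + 1) / c := by positivity
    set δ : ℝ := 1 / 2 * Real.exp (-((|C| + 1) / c)) with hδ
    have hδ0 : 0 < δ := by positivity
    have hδ2 : δ ≤ 1 / 2 := by
      have := Real.exp_le_one_iff.2 (neg_nonpos.2 hpos.le)
      linarith
    obtain ⟨t, ht, htp⟩ := (Measure.dense_of_ae hpdf).exists_between hδ0
    have hle := hlog t htp.1 (htp.2.le.trans hδ2)
    rw [ht] at hle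
    have hbig : |C| + 1 ≤ c * Real.log (1 / 2 / t) := by
      rw [← div_le_iff₀' hc, Real.le_log_iff_exp_le (by have := htp.1; positivity),
        le_div_iff₀ htp.1]
      calc _ ≤ Real.exp ((|C| + 1) / c) * δ := by gcongr; exact htp.2.le
        _ = 1 / 2 * (Real.exp ((|C| + 1) / c) * Real.exp (-((|C| + 1) / c))) := by rw [hδ]; ring
        _ = 1 / 2 := by rw [← Real.exp_add, add_neg_cancel, Real.exp_zero, mul_one]
    have hfin := (ENNReal.ofReal_le_ofReal hbig).trans hle
    have hup : pT t ≤ |C| := (le_abs_self _).trans ((hC t htp.1.ne').trans (le_abs_self C))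
    have := (ENNReal.ofReal_lt_ofReal_iff (by positivity)).2 (lt_add_one |C|)
    exact absurd (hfin.trans (ENNReal.ofReal_le_ofReal hup)) this.not_ge
  · intro hr1
    obtain ⟨K, hK⟩ := exists_ncChiSqDiffPdf_le hr1 h1 h2
    refine ⟨K, fun x hx => ?_⟩
    have hfreq : ∃ᶠ y in nhds x, pT y ∈ Set.Icc (0 : ℝ) K := by
      refine (mem_closure_iff_frequently.1 (Measure.dense_of_ae hpdf x)).mono fun y hy => ?_
      have hpos := ncChiSqDiffPdf_pos hr h1 h2 y
      have hle := hK y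
      rw [hy] at hpos hle
      exact ⟨(ENNReal.ofReal_pos.1 hpos).le, by
        rw [← ENNReal.ofReal_coe_nnreal] at hle
        exact (ENNReal.ofReal_le_ofReal_iff K.2).1 hle⟩
    have hmem := isClosed_Icc.mem_of_frequently_of_tendsto hfreq
      (hcont.continuousAt (isOpen_compl_singleton.mem_nhds hx))
    rw [abs_of_nonneg hmem.1]
    exact hmem.2

end
end
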